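/- Let n be a positive integer, let 1/n ≤ a ≤ x, and set α = ⌊na⌋/n. Then exp(−1/(2nα))/√(2πnα) · exp(−n·H(α,x)) ≤ P(N_{nx} ≤ na). -/

import Mathlib

open Real

/-- Poisson probability mass function with mean `lam`: `P(N_lam = k)`. -/
noncomputable def poissonProb (lam : ℝ) (k : ℕ) : ℝ := lam ^ k * Real.exp (-lam) / k.factorial

/-- Kullback–Leibler divergence between Poisson random variables with means `t` and `x`. -/
noncomputable def H (t x : ℝ) : ℝ := t * Real.log (t / x) - t + x

theorem log_stirlingSeq_le {k : ℕ} (hk : k ≠ 0) :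
    log (Stirling.stirlingSeq k) ≤ log √π + 1 / (12 * k) := by
  obtain ⟨m, rfl⟩ := Nat.exists_eq_succ_of_ne_zero hk
  let f : ℕ → ℝ := fun j ↦ log (Stirling.stirlingSeq (j + 1)) - 1 / (12 * ((j + 1 : ℕ) : ℝ))
  have hmono : Monotone f := by
    refine monotone_nat_of_le_succ fun j ↦ ?_
    have h := Stirling.log_stirlingSeq_sdiff_le (j + 1)
    have e : (1 : ℝ) / (12 * ((j + 1 : ℕ) : ℝ) * (((j + 1 : ℕ) : ℝ) + 1)) =
        1 / (12 * ((j + 1 : ℕ) : ℝ)) - 1 / (12 * ((j + 1 + 1 : ℕ) : ℝ)) := by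
      push_cast
      field
    rw [e] at h
    simp only [f]
    linarith
  have hlim : Filter.Tendsto f Filter.atTop (nhds (log √π - 0)) := by
    refine Filter.Tendsto.sub ?_ ?_
    · exact (Stirling.tendsto_stirlingSeq_sqrt_pi.comp (Filter.tendsto_add_atTop_nat 1)).log
        (by positivity)
    · refine Filter.Tendsto.div_atTop tendsto_const_nhds ?_
      exact (tendsto_natCast_atTop_atTop.comp (Filter.tendsto_add_atTop_nat 1)).const_mul_atTop
        (by norm_num)
  have h := hmono.ge_of_tendsto hlim m
  simp only [f, Nat.succ_eq_add_one] at h ⊢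
  linarith

theorem log_factorial_le_stirling {k : ℕ} (hk : k ≠ 0) :
    log k.factorial ≤ k * log k - k + log (2 * π * k) / 2 + 1 / (2 * k) := by
  have hk' : (0 : ℝ) < k := by positivity
  have h := log_stirlingSeq_le hk
  have hle : (1 : ℝ) / (12 * k) ≤ 1 / (2 * k) := by gcongr; norm_num
  rw [Stirling.log_stirlingSeq_formula, log_sqrt pi_pos.le, log_div hk'.ne' (exp_ne_zero _),
    log_exp, log_mul two_ne_zero hk'.ne'] at h
  rw [log_mul (by positivity) hk'.ne', log_mul two_ne_zero pi_ne_zero]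
  linarith

theorem poissonProb_nonneg {lam : ℝ} (h : 0 ≤ lam) (k : ℕ) : 0 ≤ poissonProb lam k := by
  unfold poissonProb
  positivity

theorem poissonProb_ge_exp_neg_H {lam : ℝ} (hlam : 0 < lam) {k : ℕ} (hk : k ≠ 0) :
    exp (-1 / (2 * k)) / √(2 * π * k) * exp (-H k lam) ≤ poissonProb lam k := by
  have hk' : (0 : ℝ) < k := by positivity
  have h := log_factorial_le_stirling hk
  have hprob : log (lam ^ k * exp (-lam) / k.factorial) = k * log lam - lam - log k.factorial := by
    rw [log_div (by positivity) (by positivity), log_mul (by positivity) (by positivity), log_exp,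
      log_pow, sub_eq_add_neg (_ * _)]
  unfold poissonProb H
  rw [← log_le_log_iff (by positivity) (by positivity), hprob,
    log_mul (by positivity) (by positivity), log_div (by positivity) (by positivity), log_exp,
    log_exp, log_sqrt (by positivity), log_div hk'.ne' hlam.ne', neg_div]
  linarith

theorem poisson_left_tail_lower (n : ℕ) (hn : 0 < n) (a x : ℝ) (ha : 1 / n ≤ a) (hax : a ≤ x)
    (α : ℝ) (hα : α = (⌊(n : ℝ) * a⌋ : ℝ) / n) :
    Real.exp (-1 / (2 * n * α)) / Real.sqrt (2 * π * n * α) * Real.exp (-(n : ℝ) * H α x) ≤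
      ∑' k : ℕ, if (k : ℝ) ≤ (n : ℝ) * a then poissonProb ((n : ℝ) * x) k else 0 := by
  have hn' : (0 : ℝ) < n := by positivity
  have hx : 0 < x := (by positivity : (0 : ℝ) < 1 / n).trans_le (ha.trans hax)
  have hna : 1 ≤ n * a := by rwa [div_le_iff₀' hn'] at ha
  set k := ⌊(n : ℝ) * a⌋₊ with hkdef
  have hk : k ≠ 0 := (Nat.floor_pos.2 hna).ne'
  have hkle : (k : ℝ) ≤ n * a := Nat.floor_le (by positivity)
  have hnα : n * α = k := by
    rw [hα, mul_div_cancel₀ _ hn'.ne', hkdef, natCast_floor_eq_intCast_floor (by positivity)]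
  have hH : n * H α x = H k (n * x) := by
    unfold H
    rw [← hnα, mul_div_mul_left _ _ hn'.ne']
    ring
  rw [mul_assoc 2, mul_assoc (2 * π), neg_mul, hH, hnα]
  refine (poissonProb_ge_exp_neg_H (by positivity) hk).trans ?_
  have hsum : Summable fun j : ℕ ↦
      if (j : ℝ) ≤ (n : ℝ) * a then poissonProb ((n : ℝ) * x) j else 0 := by
    refine summable_of_ne_finset_zero (s := Finset.range (k + 1)) fun j hj ↦ if_neg fun h ↦ hj ?_
    exact Finset.mem_range_succ_iff.2 (Nat.le_floor h)
  refine le_trans (if_pos hkle).ge (hsum.le_tsum k fun j _ ↦ ?_)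
  split_ifs
  · exact poissonProb_nonneg (by positivity) j
  · exact le_rfl
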